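/- arXiv:1606.00304 — 4 statements merged into one kernel-verified Lean document; each statement's English description precedes it below -/
import Mathlib

section
/- Fix d ∈ ℕ. There exists k_d ∈ ℕ, depending only on d, such that for each k ≥ k_d the set W^{(k)} is nonempty; moreover, one can choose w^{(k)} ∈ W^{(k)} for each k ≥ k_d in such a way that sup_{k ≥ k_d} ‖w^{(k)}‖ < ∞ (Euclidean norm). -/
open MeasureTheory Filter

noncomputable section

namespace EntropyKL

/-- Euclidean space `ℝ^d`. -/
abbrev Euc (d : ℕ) := EuclideanSpace ℝ (Fin d)

/-- `V_d`, the volume of the unit ball in `ℝ^d`. -/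
def Vd (d : ℕ) : ℝ := Real.pi ^ ((d : ℝ) / 2) / Real.Gamma (1 + (d : ℝ) / 2)

/-- The digamma function at a positive integer `j`:
`Ψ(j) = -γ_E + ∑_{r=1}^{j-1} 1/r`. -/
def digammaNat (j : ℕ) : ℝ :=
  -Real.eulerMascheroniConstant + ∑ r ∈ Finset.range (j - 1), (1 : ℝ) / (r + 1)

/-- `f` is a probability density (w.r.t. Lebesgue measure) on `ℝ^d`. -/
def IsDensity {d : ℕ} (f : Euc d → ℝ) : Prop :=
  (∀ x, 0 ≤ f x) ∧ Measurable f ∧ (∫ x, f x) = 1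

/-- The probability measure with density `f`. -/
def densMeasure {d : ℕ} (f : Euc d → ℝ) : Measure (Euc d) :=
  (volume : Measure (Euc d)).withDensity fun x => ENNReal.ofReal (f x)

/-- The joint law of `n` i.i.d. observations `X_1, …, X_n` with density `f`. -/
def sampleMeasure {d : ℕ} (f : Euc d → ℝ) (n : ℕ) : Measure (Fin n → Euc d) :=
  Measure.pi fun _ => densMeasure f

/-- The class `𝒜` of decreasing functions `a : (0,∞) → [1,∞)` with
`a(δ) = o(δ^{-ε})` as `δ ↓ 0` for every `ε > 0`. -/
def IsA (a : ℝ → ℝ) : Prop :=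
  (∀ δ : ℝ, 0 < δ → 1 ≤ a δ) ∧ (∀ δ₁ δ₂ : ℝ, 0 < δ₁ → δ₁ ≤ δ₂ → a δ₂ ≤ a δ₁) ∧
    ∀ ε : ℝ, 0 < ε →
      Tendsto (fun δ : ℝ => a δ * δ ^ ε) (nhdsWithin 0 (Set.Ioi 0)) (nhds 0)

/-- The radius `r_a(x) = {8 √d a(f(x))}^{-1/(β ∧ 1)}`. -/
def rA (d : ℕ) (a : ℝ → ℝ) (β : ℝ) (f : Euc d → ℝ) (x : Euc d) : ℝ :=
  (8 * Real.sqrt d * a (f x)) ^ (-(1 / min β 1))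

/-- `M_{f,a,β}(x) ≤ bound`, expressed with the denominators cleared.  Here
`m = ⌈β⌉ - 1` and `f^{(t)}` is interpreted via iterated Fréchet derivatives. -/
def SmoothBoundAt (d : ℕ) (a : ℝ → ℝ) (β : ℝ) (f : Euc d → ℝ) (x : Euc d)
    (bound : ℝ) : Prop :=
  (∀ t : ℕ, 1 ≤ t → t ≤ ⌈β⌉₊ - 1 → ‖iteratedFDeriv ℝ t f x‖ ≤ bound * f x) ∧
    ∀ y : Euc d, 0 < ‖y - x‖ → ‖y - x‖ ≤ rA d a β f x →
      ‖iteratedFDeriv ℝ (⌈β⌉₊ - 1) f y - iteratedFDeriv ℝ (⌈β⌉₊ - 1) f x‖ ≤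
        bound * f x * ‖y - x‖ ^ (β - ((⌈β⌉₊ - 1 : ℕ) : ℝ))

/-- Membership `f ∈ F_{d,θ}` for `θ = (α, β, γ, ν, a)`. -/
structure MemF (d : ℕ) (α β γ ν : ℝ) (a : ℝ → ℝ) (f : Euc d → ℝ) : Prop where
  density : IsDensity f
  moment : (∫ x, ‖x‖ ^ α * f x) ≤ ν
  bdd : ∀ x, f x ≤ γ
  smooth : ContDiff ℝ ((⌈β⌉₊ - 1 : ℕ) : ℕ∞) f
  deriv_bound : ∀ δ : ℝ, 0 < δ → ∀ x, δ ≤ f x → SmoothBoundAt d a β f x (a δ)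

/-- `ρ_{(j),i}` : the distance from `X i` to its `j`-th nearest neighbour among
the other sample points. -/
def nnDist {d n : ℕ} (X : Fin n → Euc d) (i : Fin n) (j : ℕ) : ℝ :=
  (((Finset.univ.erase i).val.map fun l => dist (X i) (X l)).sort (· ≤ ·)).getD (j - 1) 0

/-- `ξ_{(j),i} = e^{-Ψ(j)} V_d (n-1) ρ_{(j),i}^d`. -/
def xi (d : ℕ) {n : ℕ} (X : Fin n → Euc d) (i : Fin n) (j : ℕ) : ℝ :=
  Real.exp (-digammaNat j) * Vd d * ((n : ℝ) - 1) * nnDist X i j ^ d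

/-- The (unweighted) Kozachenko–Leonenko estimator with parameter `k`. -/
def klEstimator (d : ℕ) {n : ℕ} (k : ℕ) (X : Fin n → Euc d) : ℝ :=
  (n : ℝ)⁻¹ * ∑ i, Real.log (xi d X i k)

/-- The weighted Kozachenko–Leonenko estimator `Ĥ_n^w`. -/
def wKL (d : ℕ) {n k : ℕ} (w : Fin k → ℝ) (X : Fin n → Euc d) : ℝ :=
  (n : ℝ)⁻¹ * ∑ i, ∑ j : Fin k, w j * Real.log (xi d X i ((j : ℕ) + 1))

/-- The entropy `H(f) = -∫ f log f`. -/
def Hf {d : ℕ} (f : Euc d → ℝ) : ℝ := -∫ x, f x * Real.log (f x)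

/-- `V(f) = ∫ f log² f - H(f)²`. -/
def Vf {d : ℕ} (f : Euc d → ℝ) : ℝ := (∫ x, f x * Real.log (f x) ^ 2) - Hf f ^ 2

/-- The oracle estimator `H_n^* = -n⁻¹ ∑ log f(X_i)`. -/
def oracle {d n : ℕ} (f : Euc d → ℝ) (X : Fin n → Euc d) : ℝ :=
  -((n : ℝ)⁻¹ * ∑ i, Real.log (f (X i)))

/-- The weight class `W^{(k)}` (weights indexed by `j ∈ {1,…,k}` via `Fin k`). -/
def Wclass (d k : ℕ) (w : Fin k → ℝ) : Prop :=
  (∀ l : ℕ, 1 ≤ l → l ≤ d / 4 →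
      (∑ j : Fin k, w j * (Real.Gamma (((j : ℕ) : ℝ) + 1 + 2 * l / d) /
        Real.Gamma (((j : ℕ) : ℝ) + 1))) = 0) ∧
    ((∑ j : Fin k, w j) = 1) ∧
    ∀ j : Fin k, (¬∃ t : ℕ, 1 ≤ t ∧ t ≤ d ∧ (j : ℕ) + 1 = t * k / d) → w j = 0

/-- Euclidean norm of a weight vector. -/
def wNorm {k : ℕ} (w : Fin k → ℝ) : ℝ := Real.sqrt (∑ j, w j ^ 2)

/-- The bound on `τ₁`. -/
def tau1Bound (d : ℕ) (α β : ℝ) : ℝ :=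
  min (2 * α / (5 * α + 3 * d))
    (min ((α - d) / (2 * α)) (4 * min β 1 / (4 * min β 1 + 3 * d)))

/-- `τ₂ = min(1 - (d/4)/(1 + ⌊d/4⌋), 1 - d/(2β))`. -/
def tau2 (d : ℕ) (β : ℝ) : ℝ :=
  min (1 - ((d : ℝ) / 4) / (1 + ((d / 4 : ℕ) : ℝ))) (1 - (d : ℝ) / (2 * β))

/-- The bounded Lipschitz distance between two measures on `ℝ`. -/
def dBL (P Q : Measure ℝ) : ℝ :=
  sSup {r : ℝ | ∃ h : ℝ → ℝ, (∀ x, |h x| ≤ 1) ∧ (∀ x y, |h x - h y| ≤ |x - y|) ∧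
    r = |(∫ x, h x ∂P) - ∫ x, h x ∂Q|}

/-- `z_q`, the `(1-q)`-quantile of the standard normal distribution. -/
def normalQuantile (q : ℝ) : ℝ :=
  sInf {x : ℝ | 1 - q ≤ (ProbabilityTheory.gaussianReal 0 1 (Set.Iic x)).toReal}

/-- `Ṽ_n^w`. -/
def tildeV (d : ℕ) {n k : ℕ} (w : Fin k → ℝ) (X : Fin n → Euc d) : ℝ :=
  (n : ℝ)⁻¹ * (∑ i, ∑ j : Fin k, w j * Real.log (xi d X i ((j : ℕ) + 1)) ^ 2) -
    wKL d w X ^ 2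

/-- `V̂_n^w = max(Ṽ_n^w, 0)`. -/
def hatV (d : ℕ) {n k : ℕ} (w : Fin k → ℝ) (X : Fin n → Euc d) : ℝ :=
  max (tildeV d w X) 0

/-- Normalising constant `c(t)` of the path `f_{t,g}`. -/
def pathC {d : ℕ} (f g : Euc d → ℝ) (t : ℝ) : ℝ :=
  (∫ x, 2 * f x / (1 + Real.exp (-2 * t * g x)))⁻¹

/-- The path density `f_{t,g}(x) = 2c(t) f(x) / (1 + e^{-2tg(x)})`. -/
def pathDensity {d : ℕ} (f g : Euc d → ℝ) (t : ℝ) (x : Euc d) : ℝ :=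
  2 * pathC f g t * f x / (1 + Real.exp (-2 * t * g x))

/-- The score function `g_λ = λ (log f + H(f))`. -/
def scoreFn {d : ℕ} (f : Euc d → ℝ) (lam : ℝ) (x : Euc d) : ℝ :=
  lam * (Real.log (f x) + Hf f)

/-- The Laplacian `Δf(x) = ∑_j ∂²f/∂x_j²(x)`. -/
def laplacian {d : ℕ} (f : Euc d → ℝ) (x : Euc d) : ℝ :=
  ∑ j : Fin d, iteratedFDeriv ℝ 2 f x fun _ => EuclideanSpace.single j (1 : ℝ)

/-- `h_x(r) = ∫_{B_x(r)} f`. -/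
def hx {d : ℕ} (f : Euc d → ℝ) (x : Euc d) (r : ℝ) : ℝ :=
  ∫ y in Metric.closedBall x r, f y

/-- `h_x^{-1}(s) = inf{r > 0 : h_x(r) ≥ s}`. -/
def hxInv {d : ℕ} (f : Euc d → ℝ) (x : Euc d) (s : ℝ) : ℝ :=
  sInf {r : ℝ | 0 < r ∧ s ≤ hx f x r}

/-- Stirling numbers of the second kind (as reals). -/
def stirling2R (s i : ℕ) : ℝ :=
  ((i.factorial : ℝ))⁻¹ *
    ∑ l ∈ Finset.range (i + 1), (-1 : ℝ) ^ (i - l) * (i.choose l) * (l : ℝ) ^ s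

/-- The Bell numbers (as reals). -/
def bellR (m : ℕ) : ℝ := ∑ i ∈ Finset.range (m + 1), stirling2R m i

/-- The constant `D = 8 √d (71/41)^m m! (m+1)^{m+2}`. -/
def Dconst (d m : ℕ) : ℝ :=
  8 * Real.sqrt d * (71 / 41 : ℝ) ^ m * (m.factorial : ℝ) * ((m : ℝ) + 1) ^ (m + 2)

/-- The constant `C'_m = 2^{4m+9} √d B_m (m+1)^{m+1}`. -/
def CmConst (d m : ℕ) : ℝ :=
  2 ^ (4 * m + 9) * Real.sqrt d * bellR m * ((m : ℝ) + 1) ^ (m + 1)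

/-- `ã(δ) = d^{m/2} C'_m D^m a(δ/4)^{m²+m+1}`. -/
def aTilde (d m : ℕ) (a : ℝ → ℝ) (δ : ℝ) : ℝ :=
  (d : ℝ) ^ ((m : ℝ) / 2) * CmConst d m * Dconst d m ^ m * a (δ / 4) ^ (m ^ 2 + m + 1)

end EntropyKL

namespace EntropyKL

open Topology in
/-- `Γ(n + s) / Γ(n) ∼ n ^ s` as `n → ∞` through the naturals, for `s ≥ 0`. -/
theorem tendsto_Gamma_add_div_Gamma_div_rpow {s : ℝ} (hs : 0 ≤ s) :
    Tendsto (fun n : ℕ => Real.Gamma (n + s) / Real.Gamma n / (n : ℝ) ^ s) atTop (𝓝 1) := by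
  rcases hs.eq_or_lt with rfl | hs
  · refine tendsto_const_nhds.congr' ?_
    filter_upwards [eventually_gt_atTop 0] with n hn
    have : Real.Gamma n ≠ 0 := (Real.Gamma_pos_of_pos (by exact_mod_cast hn)).ne'
    simp [this]
  have hΓ := (Real.Gamma_pos_of_pos hs).ne'
  have prod_eq (n : ℕ) : Real.Gamma (n + 1 + s) =
      Real.Gamma s * ∏ j ∈ Finset.range (n + 1), (s + j) := by
    induction n with
    | zero => simp [add_comm, Real.Gamma_add_one hs.ne', mul_comm]
    | succ n ih =>
      rw [Finset.prod_range_succ, ← mul_assoc, ← ih]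
      have : (n : ℝ) + 1 + s ≠ 0 := by positivity
      have h := Real.Gamma_add_one this
      push_cast
      rw [show (n : ℝ) + 1 + 1 + s = n + 1 + s + 1 by ring, h]
      ring
  have h1 : Tendsto (fun n : ℕ => Real.Gamma s / Real.GammaSeq s n) atTop (𝓝 1) := by
    rw [← div_self hΓ]
    exact tendsto_const_nhds.div (Real.GammaSeq_tendsto_Gamma s) hΓ
  have h2 : Tendsto (fun n : ℕ => (n : ℝ) / (n + s)) atTop (𝓝 1) :=
    tendsto_natCast_div_add_atTop s
  have h3 := h1.mul h2
  rw [one_mul] at h3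
  refine h3.congr' ?_
  filter_upwards [eventually_gt_atTop 0] with n hn
  have hn' : (0 : ℝ) < n := by exact_mod_cast hn
  have hP : (0 : ℝ) < ∏ j ∈ Finset.range (n + 1), (s + j) :=
    Finset.prod_pos fun j _ => by positivity
  have e1 := prod_eq n
  rw [show (n : ℝ) + 1 + s = n + s + 1 by ring,
    Real.Gamma_add_one (by positivity : (n : ℝ) + s ≠ 0)] at e1
  have e2 := Real.Gamma_nat_eq_factorial n
  rw [Real.Gamma_add_one hn'.ne'] at e2
  have g1 := Real.Gamma_pos_of_pos hn'
  have g2 : (0 : ℝ) < (n : ℝ) ^ s := by positivity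
  rw [Real.GammaSeq, ← e2]
  field_simp
  linear_combination -e1

/-- The `t`-th admissible index `⌊(t + 1) k / d⌋`. -/
def gridIndex (d k : ℕ) (t : Fin d) : ℕ := ((t : ℕ) + 1) * k / d

/-- The Gamma-ratio moment matrix on the admissible indices, with row `l` rescaled
by `k ^ (-2l/d)`. -/
def gammaMatrix (d k : ℕ) : Matrix (Fin d) (Fin d) ℝ :=
  Matrix.of fun l t => Real.Gamma (gridIndex d k t + 2 * (l : ℕ) / d) /
    Real.Gamma (gridIndex d k t) / (k : ℝ) ^ (2 * ((l : ℕ) : ℝ) / d)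

/-- The entrywise limit of `gammaMatrix d k` as `k → ∞`. -/
def limitMatrix (d : ℕ) : Matrix (Fin d) (Fin d) ℝ :=
  (Matrix.vandermonde fun t : Fin d => ((((t : ℕ) : ℝ) + 1) / d) ^ (2 / (d : ℝ))).transpose

theorem det_limitMatrix_ne_zero {d : ℕ} (hd : 0 < d) : (limitMatrix d).det ≠ 0 := by
  rw [limitMatrix, Matrix.det_transpose, Matrix.det_vandermonde_ne_zero_iff]
  intro a b hab
  have hd' : (0 : ℝ) < d := by exact_mod_cast hd
  have h := (Real.rpow_left_inj (by positivity) (by positivity) (by positivity)).1 hab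
  field_simp at h
  exact Fin.ext (by exact_mod_cast add_right_cancel h)

open Topology in
theorem tendsto_gridIndex_div {d : ℕ} (t : Fin d) :
    Tendsto (fun k : ℕ => (gridIndex d k t : ℝ) / k) atTop
      (𝓝 ((((t : ℕ) : ℝ) + 1) / d)) := by
  have h := (tendsto_nat_floor_mul_div_atTop (R := ℝ) (a := (((t : ℕ) : ℝ) + 1) / d)
    (by positivity)).comp tendsto_natCast_atTop_atTop
  refine h.congr fun k => ?_
  have : ⌊(((t : ℕ) : ℝ) + 1) / d * k⌋₊ = gridIndex d k t := by
    rw [gridIndex, ← Nat.floor_div_eq_div (K := ℝ)]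
    push_cast
    ring_nf
  simp [this]

theorem tendsto_gridIndex {d : ℕ} (t : Fin d) :
    Tendsto (fun k : ℕ => gridIndex d k t) atTop atTop := by
  refine tendsto_atTop_mono (fun k => ?_) (Nat.tendsto_div_const_atTop (Fin.pos t).ne')
  exact Nat.div_le_div_right (Nat.le_mul_of_pos_left k (Nat.succ_pos _))

open Topology in
theorem tendsto_gammaMatrix (d : ℕ) :
    Tendsto (gammaMatrix d) atTop (𝓝 (limitMatrix d)) := by
  refine tendsto_pi_nhds.2 fun l => tendsto_pi_nhds.2 fun t => ?_
  have hs : (0 : ℝ) ≤ 2 * ((l : ℕ) : ℝ) / d := by positivity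
  have h1 := (tendsto_Gamma_add_div_Gamma_div_rpow hs).comp (tendsto_gridIndex t)
  have h2 := (tendsto_gridIndex_div t).rpow_const (p := 2 * ((l : ℕ) : ℝ) / d) (Or.inr hs)
  have h3 := h1.mul h2
  have e : limitMatrix d l t = 1 * ((((t : ℕ) : ℝ) + 1) / d) ^ (2 * ((l : ℕ) : ℝ) / d) := by
    rw [limitMatrix, Matrix.transpose_apply, Matrix.vandermonde_apply, one_mul,
      ← Real.rpow_mul_natCast (by positivity)]
    ring_nf
  rw [e]
  refine h3.congr' ?_
  filter_upwards [(tendsto_gridIndex t).eventually_gt_atTop 0] with k hk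
  have hk' : (0 : ℝ) < gridIndex d k t := by exact_mod_cast hk
  have : ((gridIndex d k t : ℝ)) ^ (2 * ((l : ℕ) : ℝ) / d) ≠ 0 := by positivity
  simp only [Function.comp_apply, gammaMatrix, Matrix.of_apply]
  rw [Real.div_rpow hk'.le (Nat.cast_nonneg k), div_mul_div_cancel₀ this]

/-- The weight vector carrying mass `v t` at the `t`-th admissible index. -/
def spread {d k : ℕ} (v : Fin d → ℝ) (j : Fin k) : ℝ :=
  ∑ t, if (j : ℕ) + 1 = gridIndex d k t then v t else 0

theorem gridIndex_pos {d k : ℕ} (hk : d ≤ k) (t : Fin d) : 0 < gridIndex d k t :=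
  Nat.div_pos (hk.trans (Nat.le_mul_of_pos_left k (Nat.succ_pos _))) (Fin.pos t)

theorem gridIndex_le {d k : ℕ} (t : Fin d) : gridIndex d k t ≤ k :=
  Nat.div_le_of_le_mul (Nat.mul_le_mul_right k t.2)

theorem sum_spread_mul {d k : ℕ} (hk : d ≤ k) (v : Fin d → ℝ) (f : ℕ → ℝ) :
    ∑ j : Fin k, spread v j * f ((j : ℕ) + 1) = ∑ t, v t * f (gridIndex d k t) := by
  simp only [spread, Finset.sum_mul]
  rw [Finset.sum_comm]
  refine Finset.sum_congr rfl fun t _ => ?_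
  have hpos := gridIndex_pos hk t
  have hle := gridIndex_le (k := k) t
  rw [Finset.sum_eq_single ⟨gridIndex d k t - 1, by omega⟩]
  · simp [Nat.sub_add_cancel hpos]
  · intro j _ hj
    rw [if_neg, zero_mul]
    exact fun h => hj (Fin.ext (by simp only; omega))
  · simp

theorem wNorm_le_sum_abs {k : ℕ} (w : Fin k → ℝ) : wNorm w ≤ ∑ j, |w j| := by
  refine Real.sqrt_le_iff.2 ⟨Finset.sum_nonneg fun _ _ => abs_nonneg _, ?_⟩
  simpa using Finset.sum_sq_le_sq_sum_of_nonneg (s := Finset.univ) (f := fun j => |w j|)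
    fun _ _ => abs_nonneg _

theorem wNorm_spread_le {d k : ℕ} (hk : d ≤ k) (v : Fin d → ℝ) :
    wNorm (spread v : Fin k → ℝ) ≤ ∑ t, |v t| := by
  refine (wNorm_le_sum_abs _).trans ?_
  calc ∑ j : Fin k, |spread v j| ≤ ∑ j : Fin k, spread (fun t => |v t|) j := by
        refine Finset.sum_le_sum fun j _ => (Finset.abs_sum_le_sum_abs _ _).trans_eq ?_
        exact Finset.sum_congr rfl fun t _ => by split_ifs <;> simp
    _ = ∑ t, |v t| := by simpa using sum_spread_mul hk (fun t => |v t|) fun _ => 1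

theorem Wclass_spread {d k : ℕ} (hd : 0 < d) (hk : d ≤ k) {v : Fin d → ℝ}
    (hv : (gammaMatrix d k).mulVec v = Pi.single ⟨0, hd⟩ 1) :
    Wclass d k (spread v) := by
  have hk0 : (0 : ℝ) < k := by exact_mod_cast hd.trans_le hk
  refine ⟨fun l hl hld => ?_, ?_, fun j hj => ?_⟩
  · have hlt : l < d := by omega
    have h := congrFun hv ⟨l, hlt⟩
    rw [Pi.single_eq_of_ne (by simp [Fin.ext_iff]; omega)] at h
    have hs := sum_spread_mul hk v
      fun i => Real.Gamma (i + 2 * l / d) / Real.Gamma i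
    push_cast at hs
    rw [hs]
    have hne : (k : ℝ) ^ (2 * (l : ℝ) / d) ≠ 0 := by positivity
    simp only [Matrix.mulVec, dotProduct, gammaMatrix, Matrix.of_apply] at h
    refine mul_right_cancel₀ (inv_ne_zero hne) ?_
    rw [Finset.sum_mul, zero_mul, ← h]
    exact Finset.sum_congr rfl fun t _ => by rw [div_eq_mul_inv _ ((k : ℝ) ^ _)]; ring
  · have h := congrFun hv ⟨0, hd⟩
    have hs := sum_spread_mul hk v fun _ => 1
    simp only [mul_one] at hs
    rw [hs]
    rw [Pi.single_eq_same] at h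
    rw [← h]
    refine Finset.sum_congr rfl fun t _ => ?_
    have : Real.Gamma (gridIndex d k t) ≠ 0 :=
      (Real.Gamma_pos_of_pos (by exact_mod_cast gridIndex_pos hk t)).ne'
    simp [gammaMatrix, this]
  · refine Finset.sum_eq_zero fun t _ => if_neg fun h => hj ⟨t + 1, by omega, t.2, h⟩

open Topology in
/-- If `A k` converges to an invertible matrix, the systems `A k *ᵥ x = b` are eventually solved
by a convergent family of vectors. -/
theorem exists_tendsto_mulVec_eq {ι α : Type*} [Fintype ι] [DecidableEq ι] {F : Filter α}
    {A : α → Matrix ι ι ℝ} {B : Matrix ι ι ℝ} (hA : Tendsto A F (𝓝 B)) (hB : B.det ≠ 0)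
    (b : ι → ℝ) :
    ∃ v : α → ι → ℝ, ∃ x, Tendsto v F (𝓝 x) ∧ ∀ᶠ k in F, (A k).mulVec (v k) = b := by
  have hdet : Tendsto (fun k => (A k).det) F (𝓝 B.det) :=
    (continuous_id.matrix_det.tendsto B).comp hA
  have hadj : Tendsto (fun k => (A k).adjugate.mulVec b) F (𝓝 (B.adjugate.mulVec b)) :=
    ((continuous_id.matrix_adjugate.matrix_mulVec continuous_const).tendsto B).comp hA
  refine ⟨_, _, (hdet.inv₀ hB).smul hadj, ?_⟩
  filter_upwards [hdet.eventually_ne hB] with k hk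
  rw [Matrix.mulVec_smul, Matrix.mulVec_mulVec, Matrix.mul_adjugate, Matrix.smul_mulVec,
    Matrix.one_mulVec, inv_smul_smul₀ hk]

/-- for every dimension `d` there is `k_d` such that for all `k ≥ k_d` the
weight class `W^{(k)}` is nonempty, with a uniformly norm-bounded choice of weights. -/
theorem Wclass_nonempty_bounded (d : ℕ) (hd : 0 < d) :
    ∃ kd : ℕ, ∃ w : (k : ℕ) → Fin k → ℝ, ∃ C : ℝ,
      ∀ k, kd ≤ k → Wclass d k (w k) ∧ wNorm (w k) ≤ C := by
  obtain ⟨v, x, hx, hv⟩ := exists_tendsto_mulVec_eq (tendsto_gammaMatrix d)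
    (det_limitMatrix_ne_zero hd) (Pi.single ⟨0, hd⟩ 1)
  have hsum : Tendsto (fun k => ∑ t, |v k t|) atTop (nhds (∑ t, |x t|)) :=
    tendsto_finsetSum _ fun t _ => (tendsto_pi_nhds.1 hx t).abs
  obtain ⟨kd, hkd⟩ := eventually_atTop.1
    ((hv.and (hsum.eventually_le_const (lt_add_one _))).and (eventually_ge_atTop d))
  refine ⟨kd, fun k => spread (v k), (∑ t, |x t|) + 1, fun k hk => ?_⟩
  obtain ⟨⟨h1, h2⟩, h3⟩ := hkd k hk
  exact ⟨Wclass_spread hd h3 h1, (wNorm_spread_le h3 _).trans h2⟩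

end EntropyKL
end
end

section
/- Let d ∈ ℕ and let f(x) = (2π)^{−d/2} e^{−‖x‖²/2} be the standard normal density on ℝ^d. Then there exists θ = (α, β, γ, ν, a) ∈ Θ such that f ∈ F_{d,θ}. -/
open MeasureTheory Filter

noncomputable section

namespace EntropyKL

/-- The function `δ ↦ 2 + 2 max(0, -log δ)` belongs to the class `𝒜`. -/
lemma isA_two_add_neg_log : IsA fun δ : ℝ => 2 + 2 * max 0 (-Real.log δ) := by
  refine ⟨fun δ _ => ?_, fun δ₁ δ₂ h₁ h₂ => ?_, fun ε hε => ?_⟩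
  · linarith [le_max_left 0 (-Real.log δ)]
  · have := Real.log_le_log h₁ h₂
    dsimp only
    gcongr
  · have hlog := tendsto_log_mul_rpow_nhdsGT_zero hε
    have hpow : Tendsto (fun δ : ℝ => δ ^ ε) (nhdsWithin 0 (Set.Ioi 0)) (nhds 0) := by
      have h := (Real.continuousAt_rpow_const 0 ε (Or.inr hε.le)).tendsto
      rw [Real.zero_rpow hε.ne'] at h
      exact h.mono_left nhdsWithin_le_nhds
    have hsum := (hpow.const_mul 2).add (((tendsto_const_nhds (x := (0 : ℝ))).max hlog.neg).const_mul 2)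
    simp only [mul_zero, neg_zero, max_self, add_zero] at hsum
    refine hsum.congr' ?_
    filter_upwards [self_mem_nhdsWithin] with δ hδ
    have hδ' : 0 ≤ δ ^ ε := Real.rpow_nonneg (le_of_lt hδ) ε
    rw [add_mul, mul_assoc, max_mul_of_nonneg _ _ hδ', zero_mul, neg_mul]

/-- The normalising constant of the standard Gaussian is at most one. -/
lemma gaussian_const_le_one (d : ℕ) : (2 * Real.pi) ^ (-(d : ℝ) / 2) ≤ 1 := by
  apply Real.rpow_le_one_of_one_le_of_nonpos
  · linarith [Real.pi_gt_three]
  · linarith [(Nat.cast_nonneg d : (0 : ℝ) ≤ d)]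

lemma isDensity_gaussian (d : ℕ) : IsDensity fun x : Euc d =>
    (2 * Real.pi) ^ (-(d : ℝ) / 2) * Real.exp (-‖x‖ ^ 2 / 2) := by
  refine ⟨fun x => by positivity, by fun_prop, ?_⟩
  have h := GaussianFourier.integral_rexp_neg_mul_sq_norm (V := Euc d)
    (by norm_num : (0 : ℝ) < 1 / 2)
  have hrw : ∀ x : Euc d, -‖x‖ ^ 2 / 2 = -(1 / 2) * ‖x‖ ^ 2 := fun x => by ring
  simp only [hrw]
  rw [integral_const_mul, h, finrank_euclideanSpace_fin,
    show Real.pi / (1 / 2) = 2 * Real.pi by ring,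
    ← Real.rpow_add (by positivity), neg_div, neg_add_cancel, Real.rpow_zero]

/-- Relative Lipschitz bound for Gaussian densities at points whose distance is small
compared with `1 / (2‖x‖ + 1)`. -/
lemma abs_exp_neg_sq_sub_le {E : Type*} [SeminormedAddCommGroup E] {x y : E} {A : ℝ}
    (hx : 2 * ‖x‖ + 1 ≤ A) (hxy : ‖y - x‖ * A ≤ 1) :
    |Real.exp (-‖y‖ ^ 2 / 2) - Real.exp (-‖x‖ ^ 2 / 2)| ≤
      A * Real.exp (-‖x‖ ^ 2 / 2) * ‖y - x‖ := by
  set r := ‖y - x‖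
  have hr : 0 ≤ r := norm_nonneg _
  have hx0 := norm_nonneg x
  have hA : 1 ≤ A := by linarith
  have hr1 : r ≤ 1 := by nlinarith
  have hdiff : |‖y‖ - ‖x‖| ≤ r := abs_norm_sub_norm_le y x
  have hy : ‖y‖ ≤ ‖x‖ + r := by linarith [le_abs_self (‖y‖ - ‖x‖)]
  set u := (‖x‖ ^ 2 - ‖y‖ ^ 2) / 2 with hu_def
  have hu : |u| ≤ r * A / 2 := by
    have : |u| = |‖y‖ - ‖x‖| * (‖y‖ + ‖x‖) / 2 := by
      rw [hu_def, abs_div, abs_two, sq_sub_sq, abs_mul, abs_of_nonneg (by positivity),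
        abs_sub_comm, add_comm, mul_comm]
    rw [this]
    gcongr
    linarith
  have hexp : |Real.exp u - 1| ≤ A * r :=
    (Real.abs_exp_sub_one_le (by linarith)).trans (by linarith)
  have hsplit : Real.exp (-‖y‖ ^ 2 / 2) = Real.exp (-‖x‖ ^ 2 / 2) * Real.exp u := by
    rw [← Real.exp_add]
    congr 1
    ring
  rw [hsplit, ← mul_sub_one, abs_mul, Real.abs_exp]
  calc _ ≤ Real.exp (-‖x‖ ^ 2 / 2) * (A * r) := by gcongr
    _ = _ := by ring

lemma norm_iteratedFDeriv_sub_of_eq_zero {E F : Type*} [NormedAddCommGroup E]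
    [NormedSpace ℝ E] [NormedAddCommGroup F] [NormedSpace ℝ F] {n : ℕ} (hn : n = 0)
    (f : E → F) (x y : E) :
    ‖iteratedFDeriv ℝ n f y - iteratedFDeriv ℝ n f x‖ = ‖f y - f x‖ := by
  subst hn
  rw [iteratedFDeriv_zero_eq_comp, Function.comp_apply, Function.comp_apply, ← map_sub,
    LinearIsometryEquiv.norm_map]

/-- A point where the Gaussian density is at least `δ` has norm controlled by `-log δ`. -/
lemma two_mul_norm_add_one_le {d : ℕ} {δ : ℝ} (hδ : 0 < δ) {x : Euc d}
    (hx : δ ≤ (2 * Real.pi) ^ (-(d : ℝ) / 2) * Real.exp (-‖x‖ ^ 2 / 2)) :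
    2 * ‖x‖ + 1 ≤ 2 + 2 * max 0 (-Real.log δ) := by
  have hle : δ ≤ Real.exp (-‖x‖ ^ 2 / 2) :=
    hx.trans (mul_le_of_le_one_left (Real.exp_nonneg _) (gaussian_const_le_one d))
  have hlog := (Real.log_le_iff_le_exp hδ).2 hle
  nlinarith [le_max_right 0 (-Real.log δ), sq_nonneg (‖x‖ - 1)]

/-- Proposition 1(i): the standard Gaussian density on `ℝ^d` belongs to
`F_{d,θ}` for some `θ ∈ Θ`. -/
theorem gaussian_mem_class (d : ℕ) (hd : 0 < d) :
    ∃ α β γ ν : ℝ, ∃ a : ℝ → ℝ, 0 < α ∧ 0 < β ∧ 0 < γ ∧ 0 < ν ∧ IsA a ∧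
      MemF d α β γ ν a fun x : Euc d =>
        (2 * Real.pi) ^ (-(d : ℝ) / 2) * Real.exp (-‖x‖ ^ 2 / 2) := by
  set f : Euc d → ℝ := fun x =>
    (2 * Real.pi) ^ (-(d : ℝ) / 2) * Real.exp (-‖x‖ ^ 2 / 2) with hf
  set a : ℝ → ℝ := fun δ => 2 + 2 * max 0 (-Real.log δ)
  have hA : IsA a := isA_two_add_neg_log
  refine ⟨1, 1, 1, max 1 (∫ x, ‖x‖ ^ (1 : ℝ) * f x), a, one_pos, one_pos, one_pos,
    lt_max_of_lt_left one_pos, hA, isDensity_gaussian d, le_max_right _ _, fun x => ?_, ?_,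
    fun δ hδ x hδx => ⟨fun t ht ht' => ?_, fun y _ hy => ?_⟩⟩
  · exact mul_le_one₀ (gaussian_const_le_one d) (Real.exp_nonneg _)
      (Real.exp_le_one_iff.2 (by linarith [sq_nonneg ‖x‖]))
  · simp only [Nat.ceil_one, tsub_self, Nat.cast_zero]
    exact contDiff_zero.2 (by fun_prop)
  · simp only [Nat.ceil_one, tsub_self] at ht'
    omega
  · have hfx : 0 < f x := by positivity
    have hx : 2 * ‖x‖ + 1 ≤ a (f x) := two_mul_norm_add_one_le hfx le_rfl
    have haδ : a (f x) ≤ a δ := hA.2.1 δ (f x) hδ hδx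
    have ha1 : 1 ≤ a (f x) := hA.1 _ hfx
    have hd1 : 1 ≤ √(d : ℝ) := Real.one_le_sqrt.2 (by exact_mod_cast hd)
    have hya : ‖y - x‖ * a (f x) ≤ 1 := by
      simp only [rA, min_self, div_one, Real.rpow_neg_one] at hy
      calc ‖y - x‖ * a (f x) ≤ (8 * √(d : ℝ) * a (f x))⁻¹ * (8 * √(d : ℝ) * a (f x)) := by
            gcongr
            nlinarith
        _ = 1 := inv_mul_cancel₀ (by positivity)
    have key := abs_exp_neg_sq_sub_le hx hya
    simp only [Nat.ceil_one, tsub_self, Nat.cast_zero, sub_zero, Real.rpow_one]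
    rw [norm_iteratedFDeriv_sub_of_eq_zero (by simp), Real.norm_eq_abs]
    have hc : 0 ≤ (2 * Real.pi) ^ (-(d : ℝ) / 2) := by positivity
    calc |f y - f x| = (2 * Real.pi) ^ (-(d : ℝ) / 2) *
          |Real.exp (-‖y‖ ^ 2 / 2) - Real.exp (-‖x‖ ^ 2 / 2)| := by
          rw [hf, ← mul_sub, abs_mul, abs_of_nonneg hc]
      _ ≤ (2 * Real.pi) ^ (-(d : ℝ) / 2) *
          (a (f x) * Real.exp (-‖x‖ ^ 2 / 2) * ‖y - x‖) := by gcongr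
      _ = a (f x) * f x * ‖y - x‖ := by rw [hf]; ring
      _ ≤ a δ * f x * ‖y - x‖ := by gcongr

end EntropyKL
end
end

section
/- Let f be the probability density on ℝ given by f(x) = C exp(−1/(1−x²)) for x ∈ (−1,1) and f(x) = 0 otherwise, where C > 0 is the normalizing constant. Then there exists θ = (α, β, γ, ν, a) ∈ Θ such that f ∈ F_{1,θ} (even though f vanishes at some points of ℝ). -/
open MeasureTheory Filter

noncomputable section

namespace EntropyKL

/-- The compactly supported bump density `f(x) ∝ exp(-1/(1-x²)) 𝟙_{x ∈ (-1,1)}` on `ℝ`. -/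
def bumpDensity (C : ℝ) : Euc 1 → ℝ := fun x =>
  if |x 0| < 1 then C * Real.exp (-(1 / (1 - x 0 ^ 2))) else 0

theorem bumpDensity_eq_expNegInvGlue (C : ℝ) (x : Euc 1) :
    bumpDensity C x = C * expNegInvGlue (1 - x 0 ^ 2) := by
  by_cases h : |x 0| < 1
  · have h' : 0 < 1 - x 0 ^ 2 := by linarith [(sq_lt_one_iff_abs_lt_one (x 0)).2 h]
    simp [bumpDensity, h, expNegInvGlue, not_le.2 h']
  · have h' : 1 - x 0 ^ 2 ≤ 0 := by
      have := mt (sq_lt_one_iff_abs_lt_one (x 0)).1 h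
      linarith
    simp [bumpDensity, h, expNegInvGlue.zero_of_nonpos h']

theorem continuous_bumpDensity (C : ℝ) : Continuous (bumpDensity C) := by
  have h : bumpDensity C = fun x => C * expNegInvGlue (1 - x 0 ^ 2) :=
    funext (bumpDensity_eq_expNegInvGlue C)
  have := (expNegInvGlue.contDiff (n := 0)).continuous
  rw [h]
  fun_prop

/-- The squared-logarithmic growth function controlling the relative increments of
`bumpDensity C`. -/
def bumpGrowth (C δ : ℝ) : ℝ := 12 * (1 + max 0 (Real.log (C / δ))) ^ 2

theorem isA_bumpGrowth {C : ℝ} (hC : 0 < C) : IsA (bumpGrowth C) := by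
  refine ⟨fun δ _ => ?_, fun δ₁ δ₂ h₁ h₁₂ => ?_, fun ε hε => ?_⟩
  · have := le_max_left 0 (Real.log (C / δ))
    unfold bumpGrowth
    nlinarith
  · have h₂ : 0 < δ₂ := h₁.trans_le h₁₂
    unfold bumpGrowth
    gcongr
  · have hpow : Tendsto (fun δ : ℝ => δ ^ (ε / 2)) (nhdsWithin 0 (Set.Ioi 0)) (nhds 0) := by
      have h := (Real.continuousAt_rpow_const 0 (ε / 2) (Or.inr (by positivity))).tendsto
      rw [Real.zero_rpow (by positivity)] at h
      exact h.mono_left nhdsWithin_le_nhds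
    have hlog := tendsto_log_mul_rpow_nhdsGT_zero (half_pos hε)
    have hlim := (((hpow.const_mul (1 + Real.log C)).sub hlog).pow 2).const_mul 12
    norm_num at hlim
    refine hlim.congr' ?_
    filter_upwards [Ioo_mem_nhdsGT hC] with δ hδ
    have hmax : max 0 (Real.log (C / δ)) = Real.log C - Real.log δ := by
      rw [max_eq_right (Real.log_nonneg ((one_le_div hδ.1).2 hδ.2.le)),
        Real.log_div hC.ne' hδ.1.ne']
    have hsq : δ ^ ε = (δ ^ (ε / 2)) ^ 2 := by
      rw [← Real.rpow_mul_natCast hδ.1.le]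
      norm_num
    rw [bumpGrowth, hmax, hsq]
    ring

/-- Relative local Lipschitz bound for `s ↦ exp (-1 / (1 - s²))` on `(-1, 1)`. -/
theorem abs_expNegInvGlue_sub_le {s t A : ℝ} (hs : 0 < 1 - s ^ 2)
    (hA : 12 * (1 + (1 - s ^ 2)⁻¹) ^ 2 = A) (hst : |t - s| ≤ (8 * A)⁻¹) :
    |expNegInvGlue (1 - t ^ 2) - expNegInvGlue (1 - s ^ 2)| ≤
      A * expNegInvGlue (1 - s ^ 2) * |t - s| := by
  obtain ⟨u, hu⟩ : ∃ u, u = 1 - s ^ 2 := ⟨_, rfl⟩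
  obtain ⟨v, hv⟩ : ∃ v, v = 1 - t ^ 2 := ⟨_, rfl⟩
  obtain ⟨r, hr⟩ : ∃ r, r = |t - s| := ⟨_, rfl⟩
  rw [← hu] at hs hA ⊢
  rw [← hv]
  rw [← hr] at hst ⊢
  have hr0 : 0 ≤ r := hr ▸ abs_nonneg _
  have hs1 : |s| ≤ 1 := (sq_le_one_iff_abs_le_one s).1 (by linarith)
  have hu1 : u ≤ 1 := by nlinarith [sq_nonneg s]
  have hAu : 12 ≤ A * u ^ 2 := by
    rw [← hA]
    field_simp
    nlinarith
  have hA0 : 0 < A := by rw [← hA]; positivity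
  have hrA : r * (8 * A) ≤ 1 := by
    rwa [← le_div_iff₀ (by positivity), one_div]
  have hru : 96 * r ≤ u ^ 2 := by
    nlinarith [mul_le_mul_of_nonneg_left hAu hr0, mul_le_mul_of_nonneg_right hrA (sq_nonneg u)]
  have hr1 : r ≤ 1 := by nlinarith
  have hvu : |u - v| ≤ 3 * r := by
    have : u - v = (t - s) * ((t - s) + 2 * s) := by rw [hu, hv]; ring
    rw [this, abs_mul, ← hr, mul_comm]
    gcongr
    calc |t - s + 2 * s| ≤ |t - s| + |2 * s| := abs_add_le _ _
      _ ≤ 3 := by rw [← hr, abs_mul, abs_two]; linarith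
  have hv2 : u / 2 ≤ v := by nlinarith [le_abs_self (u - v)]
  have hv0 : 0 < v := by linarith
  have hinv : |u⁻¹ - v⁻¹| ≤ 6 * r / u ^ 2 := by
    rw [inv_sub_inv hs.ne' hv0.ne', abs_div, abs_of_pos (mul_pos hs hv0), abs_sub_comm,
      div_le_div_iff₀ (by positivity) (by positivity)]
    calc |u - v| * u ^ 2 ≤ 3 * r * u ^ 2 := by gcongr
      _ ≤ 3 * r * (2 * (u * v)) := by gcongr; nlinarith
      _ = 6 * r * (u * v) := by ring
  have hinv1 : |u⁻¹ - v⁻¹| ≤ 1 := hinv.trans <| by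
    rw [div_le_one (by positivity)]
    linarith
  have hfac : expNegInvGlue v - expNegInvGlue u =
      expNegInvGlue u * (Real.exp (u⁻¹ - v⁻¹) - 1) := by
    simp only [expNegInvGlue, not_le.2 hs, not_le.2 hv0, if_false]
    rw [mul_sub, ← Real.exp_add]
    ring_nf
  rw [hfac, abs_mul, abs_of_nonneg (expNegInvGlue.nonneg u), mul_comm A, mul_assoc]
  gcongr
  · exact expNegInvGlue.nonneg u
  calc |Real.exp (u⁻¹ - v⁻¹) - 1| ≤ 2 * |u⁻¹ - v⁻¹| := Real.abs_exp_sub_one_le hinv1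
    _ ≤ 2 * (6 * r / u ^ 2) := by gcongr
    _ ≤ A * r := by
      rw [← mul_div_assoc, div_le_iff₀ (by positivity)]
      nlinarith

theorem bumpGrowth_bumpDensity {C : ℝ} (hC : 0 < C) {x : Euc 1} (hx : 0 < 1 - x 0 ^ 2) :
    12 * (1 + (1 - x 0 ^ 2)⁻¹) ^ 2 = bumpGrowth C (bumpDensity C x) := by
  have hdiv : C / (C * Real.exp (-(1 - x 0 ^ 2)⁻¹)) = Real.exp (1 - x 0 ^ 2)⁻¹ := by
    rw [Real.exp_neg]
    field_simp
  rw [bumpDensity_eq_expNegInvGlue, bumpGrowth, expNegInvGlue, if_neg (not_le.2 hx), hdiv,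
    Real.log_exp, max_eq_right (by positivity)]

theorem smoothBoundAt_bumpDensity {C δ : ℝ} (hC : 0 < C) (hδ : 0 < δ) {x : Euc 1}
    (hx : δ ≤ bumpDensity C x) :
    SmoothBoundAt 1 (bumpGrowth C) 1 (bumpDensity C) x (bumpGrowth C δ) := by
  have hfx : 0 < bumpDensity C x := hδ.trans_le hx
  have hx0 : 0 < 1 - x 0 ^ 2 := by
    by_contra h
    rw [bumpDensity_eq_expNegInvGlue, expNegInvGlue.zero_of_nonpos (not_lt.1 h)] at hfx
    simp at hfx
  refine ⟨fun t ht ht' => ?_, fun y _ hy => ?_⟩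
  · simp only [Nat.ceil_one] at ht'
    omega
  have hnorm (z : Euc 1) : ‖z‖ = |z 0| := by
    simp [EuclideanSpace.norm_eq, Real.sqrt_sq_eq_abs]
  have hball : |y 0 - x 0| ≤ (8 * bumpGrowth C (bumpDensity C x))⁻¹ := by
    simpa [rA, Real.rpow_neg_one, hnorm] using hy
  have key := abs_expNegInvGlue_sub_le hx0 (bumpGrowth_bumpDensity hC hx0) hball
  have hm : ⌈(1 : ℝ)⌉₊ - 1 = 0 := by simp
  rw [hm, Nat.cast_zero, sub_zero, Real.rpow_one]
  rw [iteratedFDeriv_zero_eq_comp, Function.comp_apply, Function.comp_apply, ← map_sub,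
    LinearIsometryEquiv.norm_map, Real.norm_eq_abs, hnorm, PiLp.sub_apply]
  calc |bumpDensity C y - bumpDensity C x|
      = C * |expNegInvGlue (1 - y 0 ^ 2) - expNegInvGlue (1 - x 0 ^ 2)| := by
        simp only [bumpDensity_eq_expNegInvGlue]
        rw [← mul_sub, abs_mul, abs_of_pos hC]
    _ ≤ C * (bumpGrowth C (bumpDensity C x) * expNegInvGlue (1 - x 0 ^ 2) * |y 0 - x 0|) := by
        gcongr
    _ = bumpGrowth C (bumpDensity C x) * bumpDensity C x * |y 0 - x 0| := by
        rw [bumpDensity_eq_expNegInvGlue]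
        ring
    _ ≤ bumpGrowth C δ * bumpDensity C x * |y 0 - x 0| := by
        gcongr
        exact (isA_bumpGrowth hC).2.1 δ _ hδ hx

/-- Proposition 1, final part: the bump density belongs to `F_{1,θ}`
for some `θ ∈ Θ`, even though it vanishes at some points. -/
theorem bump_mem_class (C : ℝ) (hC : 0 < C)
    (hnorm : (∫ x : Euc 1, bumpDensity C x) = 1) :
    ∃ α β γ ν : ℝ, ∃ a : ℝ → ℝ, 0 < α ∧ 0 < β ∧ 0 < γ ∧ 0 < ν ∧ IsA a ∧
      MemF 1 α β γ ν a (bumpDensity C) := by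
  refine ⟨1, 1, C, max 1 (∫ x, ‖x‖ ^ (1 : ℝ) * bumpDensity C x), bumpGrowth C, one_pos, one_pos,
    hC, by positivity, isA_bumpGrowth hC, ⟨fun x => ?_, (continuous_bumpDensity C).measurable,
    hnorm⟩, le_max_right _ _, fun x => ?_, ?_, fun δ hδ x hx => smoothBoundAt_bumpDensity hC hδ hx⟩
  · rw [bumpDensity_eq_expNegInvGlue]
    exact mul_nonneg hC.le (expNegInvGlue.nonneg _)
  · unfold bumpDensity
    split_ifs with h
    · have h' : 0 < 1 - x 0 ^ 2 := by linarith [(sq_lt_one_iff_abs_lt_one (x 0)).2 h]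
      exact mul_le_of_le_one_right hC.le (Real.exp_le_one_iff.2 (by simpa using h'.le))
    · exact hC.le
  · simpa using (contDiff_zero (𝕜 := ℝ)).2 (continuous_bumpDensity C)

end EntropyKL
end
end

section
/- Let f be a bounded probability density on ℝ^d and let α > 0 with μ_α(f) := ∫ ‖x‖^α f(x) dx < ∞. Then for every s ∈ (0,1) and every x ∈ ℝ^d, ( s / (V_d ‖f‖_∞) )^{1/d} ≤ h_x^{−1}(s) ≤ ‖x‖ + ( μ_α(f)/(1−s) )^{1/α}. -/
open MeasureTheory Filter

noncomputable section

namespace EntropyKL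

lemma IsDensity.integrable {d : ℕ} {f : Euc d → ℝ} (hf : IsDensity f) : Integrable f := by
  by_contra h
  have := hf.2.2
  rw [integral_undef h] at this
  exact zero_ne_one this

lemma Vd_pos (d : ℕ) : 0 < Vd d :=
  div_pos (Real.rpow_pos_of_pos Real.pi_pos _) (Real.Gamma_pos_of_pos (by positivity))

lemma volume_real_closedBall {d : ℕ} (hd : 0 < d) (x : Euc d) {r : ℝ} (hr : 0 ≤ r) :
    volume.real (Metric.closedBall x r) = r ^ d * Vd d := by
  have : Nonempty (Fin d) := Fin.pos_iff_nonempty.mp hd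
  have hV : √Real.pi ^ d / Real.Gamma ((d : ℝ) / 2 + 1) = Vd d := by
    rw [Vd, add_comm, Real.sqrt_eq_rpow, ← Real.rpow_natCast, ← Real.rpow_mul Real.pi_pos.le]
    ring_nf
  rw [Measure.real, EuclideanSpace.volume_closedBall, Fintype.card_fin, hV, ENNReal.toReal_mul,
    ENNReal.toReal_pow, ENNReal.toReal_ofReal hr, ENNReal.toReal_ofReal (Vd_pos d).le]

/-- The mass of a ball is at most its volume times the supremum of the density. -/
lemma hx_le {d : ℕ} (hd : 0 < d) {f : Euc d → ℝ} (hf : IsDensity f)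
    (hbd : BddAbove (Set.range f)) (x : Euc d) {r : ℝ} (hr : 0 ≤ r) :
    hx f x r ≤ r ^ d * (Vd d * sSup (Set.range f)) := by
  have hfin : volume (Metric.closedBall x r) ≠ ⊤ := measure_closedBall_lt_top.ne
  calc hx f x r ≤ ∫ _ in Metric.closedBall x r, sSup (Set.range f) :=
        setIntegral_mono hf.integrable.integrableOn (integrableOn_const hfin)
          fun y => le_csSup hbd ⟨y, rfl⟩
    _ = r ^ d * (Vd d * sSup (Set.range f)) := by
        rw [setIntegral_const, volume_real_closedBall hd x hr, smul_eq_mul, mul_assoc]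

/-- Markov's inequality for the mass outside the ball of radius `‖x‖ + t` about `x`. -/
lemma rpow_le_rpow_mul_hx_add {d : ℕ} {f : Euc d → ℝ} (hf : IsDensity f) {α : ℝ} (hα : 0 ≤ α)
    (hint : Integrable fun x : Euc d => ‖x‖ ^ α * f x) (x : Euc d) {t : ℝ} (ht : 0 ≤ t) :
    t ^ α ≤ t ^ α * hx f x (‖x‖ + t) + ∫ y, ‖y‖ ^ α * f y := by
  have hB : MeasurableSet (Metric.closedBall x (‖x‖ + t)) := measurableSet_closedBall
  have hind : Integrable ((Metric.closedBall x (‖x‖ + t)).indicator f) :=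
    hf.integrable.indicator hB
  have hpt : ∀ y, t ^ α * f y ≤
      t ^ α * (Metric.closedBall x (‖x‖ + t)).indicator f y + ‖y‖ ^ α * f y := by
    intro y
    have hy0 := hf.1 y
    by_cases hy : y ∈ Metric.closedBall x (‖x‖ + t)
    · rw [Set.indicator_of_mem hy]
      have : 0 ≤ ‖y‖ ^ α * f y := by positivity
      linarith
    · rw [Set.indicator_of_notMem hy, mul_zero, zero_add]
      have hty : t ≤ ‖y‖ := by
        rw [Metric.mem_closedBall, not_le, dist_eq_norm] at hy
        linarith [norm_sub_le y x]
      gcongr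
  have h := integral_mono (hf.integrable.const_mul (t ^ α))
    ((hind.const_mul (t ^ α)).add hint) hpt
  rw [integral_add' (hind.const_mul (t ^ α)) hint, integral_const_mul, integral_const_mul,
    integral_indicator hB, hf.2.2, mul_one] at h
  exact h

/-- Every radius exceeding the moment bound captures mass at least `s`. -/
lemma le_hx_of_moment {d : ℕ} {f : Euc d → ℝ} (hf : IsDensity f) {α : ℝ} (hα : 0 < α)
    (hint : Integrable fun x : Euc d => ‖x‖ ^ α * f x) {s : ℝ} (hs : s < 1) (x : Euc d)
    {t : ℝ} (ht : 0 < t) (hRt : ((∫ y, ‖y‖ ^ α * f y) / (1 - s)) ^ (1 / α) ≤ t) :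
    s ≤ hx f x (‖x‖ + t) := by
  have hs' : 0 < 1 - s := sub_pos.mpr hs
  have hμ : 0 ≤ ∫ y, ‖y‖ ^ α * f y :=
    integral_nonneg fun y => mul_nonneg (by positivity) (hf.1 y)
  have hpow : (∫ y, ‖y‖ ^ α * f y) ≤ t ^ α * (1 - s) := by
    rw [← div_le_iff₀ hs']
    rwa [one_div, Real.rpow_inv_le_iff_of_pos (by positivity) ht.le hα] at hRt
  have hM := rpow_le_rpow_mul_hx_add hf hα.le hint x ht.le
  refine le_of_mul_le_mul_left ?_ (Real.rpow_pos_of_pos ht α)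
  linarith

/-- Lemma 3(i): crude bounds on `h_x^{-1}(s)`. -/
theorem hxInv_crude_bounds
    (d : ℕ) (hd : 0 < d) (f : Euc d → ℝ) (hf : IsDensity f)
    (hbd : BddAbove (Set.range f))
    (α : ℝ) (hα : 0 < α) (hint : Integrable fun x : Euc d => ‖x‖ ^ α * f x) :
    ∀ s : ℝ, 0 < s → s < 1 → ∀ x : Euc d,
      (s / (Vd d * sSup (Set.range f))) ^ ((1 : ℝ) / d) ≤ hxInv f x s ∧
        hxInv f x s ≤ ‖x‖ + ((∫ y, ‖y‖ ^ α * f y) / (1 - s)) ^ (1 / α) := by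
  intro s hs0 hs1 x
  set R := ((∫ y, ‖y‖ ^ α * f y) / (1 - s)) ^ (1 / α) with hR
  have hR0 : 0 ≤ R := by
    have : 0 ≤ ∫ y, ‖y‖ ^ α * f y :=
      integral_nonneg fun y => mul_nonneg (by positivity) (hf.1 y)
    have : 0 ≤ 1 - s := by linarith
    positivity
  have hmem : ∀ ε : ℝ, 0 < ε → ‖x‖ + (R + ε) ∈ {r : ℝ | 0 < r ∧ s ≤ hx f x r} := fun ε hε =>
    ⟨by positivity, le_hx_of_moment hf hα hint hs1 x (by positivity) (by linarith)⟩
  constructor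
  · refine le_csInf ⟨_, hmem 1 one_pos⟩ ?_
    rintro r ⟨hr, hsr⟩
    have hle := hsr.trans (hx_le hd hf hbd x hr.le)
    have hc : 0 < Vd d * sSup (Set.range f) :=
      pos_of_mul_pos_right (hs0.trans_le hle) (by positivity)
    rw [one_div, Real.rpow_inv_le_iff_of_pos (by positivity) hr.le (by exact_mod_cast hd),
      Real.rpow_natCast, div_le_iff₀ hc]
    exact hle
  · refine le_of_forall_pos_le_add fun ε hε => ?_
    rw [add_assoc]
    exact csInf_le ⟨0, fun r hr => hr.1.le⟩ (hmem ε hε)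

end EntropyKL
end
end
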